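/- Let α be a badly approximable real number with convergents (pₙ/qₙ)_{n ≥ 1}. Assume there exist a positive rational number x and two sequences of finite words (U_k)_{k ≥ 1} and (V_k)_{k ≥ 1} over the positive integers such that, for every k ≥ 1, the continued fraction expansion of α begins with the block V_k, followed by U_k, followed by the mirror image Ū_k, and |U_{k+1}| > |U_k| ≥ x·|V_k|. Set M = limsup_{ℓ → ∞} q_ℓ^{1/ℓ} and m = liminf_{ℓ → ∞} q_ℓ^{1/ℓ}, and assume x > (3/2)·(log M)/(log m) − 1/2. Then there exists a real number ε with 0 < ε < 1, depending on x, such that for every real number β equal to α up to a rational homography there are infinitely many positive integers q with q · ‖qα‖ · ‖qβ‖ ≤ q^{-(1-ε)}. -/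

import Mathlib

open Filter Topology

/-- Distance from a real number to the nearest integer. -/
noncomputable def nint (x : ℝ) : ℝ := |x - round x|

/-- A real number is badly approximable: `inf_{q ≥ 1} q·‖qα‖ > 0`. -/
def IsBad (α : ℝ) : Prop :=
  0 < ⨅ q : ℕ+, ((q : ℕ) : ℝ) * nint (((q : ℕ) : ℝ) * α)

/-- Denominators (continuants) of the continued fraction `[0; a 1, a 2, …]`:
`q 0 = 1`, `q 1 = a 1`, `q (j+2) = a (j+2) * q (j+1) + q j`. -/
def cfQ (a : ℕ → ℕ) : ℕ → ℕ
  | 0 => 1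
  | 1 => a 1
  | n + 2 => a (n + 2) * cfQ a (n + 1) + cfQ a n

/-- Numerators of the continued fraction `[0; a 1, a 2, …]`. -/
def cfP (a : ℕ → ℕ) : ℕ → ℕ
  | 0 => 0
  | 1 => 1
  | n + 2 => a (n + 2) * cfP a (n + 1) + cfP a n

/-- `a` (indexed from `1`) is the sequence of partial quotients of the continued
fraction expansion of `α`, i.e. `α = [0; a 1, a 2, …]`. -/
def IsCF (a : ℕ → ℕ) (α : ℝ) : Prop :=
  (∀ i, 1 ≤ i → 1 ≤ a i) ∧
    Tendsto (fun n => (cfP a n : ℝ) / (cfQ a n)) atTop (nhds α)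

lemma nint_le_abs_sub_intCast (x : ℝ) (n : ℤ) : nint x ≤ |x - n| := round_le x n

lemma nint_nonneg (x : ℝ) : 0 ≤ nint x := abs_nonneg _

lemma nint_natAbs_mul_le (z n : ℤ) (y : ℝ) : nint ((z.natAbs : ℝ) * y) ≤ |z * y - n| := by
  rw [Nat.cast_natAbs, Int.cast_abs]
  rcases abs_choice (z : ℝ) with h | h <;> rw [h]
  · exact nint_le_abs_sub_intCast _ n
  · refine (nint_le_abs_sub_intCast _ (-n)).trans_eq ?_
    rw [← abs_neg]
    congr 1
    push_cast
    ring

section Continuants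

variable {a : ℕ → ℕ}

lemma cfQ_pos (ha : ∀ i, 1 ≤ i → 1 ≤ a i) : ∀ n, 0 < cfQ a n
  | 0 => Nat.one_pos
  | 1 => ha 1 le_rfl
  | n + 2 => by
    rw [cfQ]
    exact Nat.add_pos_right _ (cfQ_pos ha n)

lemma cfQ_add_le (ha : ∀ i, 1 ≤ i → 1 ≤ a i) (n : ℕ) :
    cfQ a (n + 1) + cfQ a n ≤ cfQ a (n + 2) := by
  rw [cfQ]
  exact Nat.add_le_add_right (Nat.le_mul_of_pos_left _ (ha _ (by omega))) _

lemma cfQ_monotone (ha : ∀ i, 1 ≤ i → 1 ≤ a i) : Monotone (cfQ a) := by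
  refine monotone_nat_of_le_succ fun n => ?_
  cases n with
  | zero => exact ha 1 le_rfl
  | succ n => exact (Nat.le_add_right _ _).trans (cfQ_add_le ha n)

lemma le_cfQ (ha : ∀ i, 1 ≤ i → 1 ≤ a i) : ∀ n, n ≤ cfQ a n
  | 0 => Nat.zero_le _
  | 1 => ha 1 le_rfl
  | n + 2 => by
    have h₁ := le_cfQ ha (n + 1)
    have h₂ := cfQ_pos ha n
    have h₃ := cfQ_add_le ha n
    omega

lemma two_pow_le_cfQ_pow_four (ha : ∀ i, 1 ≤ i → 1 ≤ a i) :
    ∀ n, 2 ^ (n + 2) ≤ cfQ a (n + 2) ^ 4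
  | 0 => by
    calc 2 ^ (0 + 2) ≤ 2 ^ 4 := by norm_num
      _ ≤ _ := Nat.pow_le_pow_left (le_cfQ ha 2) 4
  | 1 => by
    calc 2 ^ (1 + 2) ≤ 3 ^ 4 := by norm_num
      _ ≤ _ := Nat.pow_le_pow_left (le_cfQ ha 3) 4
  | n + 2 => by
    have h₁ := two_pow_le_cfQ_pow_four ha n
    have h₂ : 2 * cfQ a (n + 2) ≤ cfQ a (n + 2 + 2) := by
      have h₃ := cfQ_add_le ha (n + 2)
      have h₄ := cfQ_monotone ha (Nat.le_succ (n + 2))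
      simp only [Nat.succ_eq_add_one] at h₄
      omega
    calc 2 ^ (n + 2 + 2) ≤ 16 * 2 ^ (n + 2) := by rw [pow_add]; omega
      _ ≤ 16 * cfQ a (n + 2) ^ 4 := Nat.mul_le_mul_left _ h₁
      _ = (2 * cfQ a (n + 2)) ^ 4 := by ring
      _ ≤ _ := Nat.pow_le_pow_left h₂ 4

lemma cfP_le_cfQ (ha : ∀ i, 1 ≤ i → 1 ≤ a i) : ∀ n, cfP a n ≤ cfQ a n
  | 0 => Nat.zero_le _
  | 1 => ha 1 le_rfl
  | n + 2 => Nat.add_le_add (Nat.mul_le_mul_left _ (cfP_le_cfQ ha (n + 1))) (cfP_le_cfQ ha n)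

lemma cfP_mul_cfQ_sub (a : ℕ → ℕ) (n : ℕ) :
    (cfP a (n + 1) : ℝ) * cfQ a n - cfP a n * cfQ a (n + 1) = (-1) ^ n := by
  induction n with
  | zero => simp [cfP, cfQ]
  | succ n ih =>
    rw [pow_succ, ← ih, show n + 1 + 1 = n + 2 from rfl, cfP, cfQ]
    push_cast
    ring

/-- Consecutive convergents lie on opposite sides of the limit. -/
lemma IsCF.signed_error_nonneg {α : ℝ} (h : IsCF a α) (n : ℕ) :
    0 ≤ (-1) ^ n * ((cfQ a n : ℝ) * α - cfP a n) := by
  have hpos : ∀ n, (0 : ℝ) < cfQ a n := fun n => by exact_mod_cast cfQ_pos h.1 n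
  let u : ℕ → ℝ := fun k => (-1) ^ n * ((cfP a (n + 2 * k) : ℝ) / cfQ a (n + 2 * k))
  have hmono : Monotone u := by
    refine monotone_nat_of_le_succ fun k => ?_
    have hd := cfP_mul_cfQ_sub a (n + 2 * k)
    have hs : ((-1 : ℝ) ^ (n + 2 * k)) = (-1) ^ n := by simp [pow_add, pow_mul]
    rw [hs] at hd
    have hP : (cfP a (n + 2 * (k + 1)) : ℝ)
        = a (n + 2 * k + 2) * cfP a (n + 2 * k + 1) + cfP a (n + 2 * k) := by
      rw [show n + 2 * (k + 1) = n + 2 * k + 2 by ring, cfP]; push_cast; ring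
    have hQ : (cfQ a (n + 2 * (k + 1)) : ℝ)
        = a (n + 2 * k + 2) * cfQ a (n + 2 * k + 1) + cfQ a (n + 2 * k) := by
      rw [show n + 2 * (k + 1) = n + 2 * k + 2 by ring, cfQ]; push_cast; ring
    have hsq : ((-1 : ℝ) ^ n) * (-1) ^ n = 1 := by rw [← mul_pow]; simp
    rw [← sub_nonneg]
    have key : u (k + 1) - u k
        = a (n + 2 * k + 2) / (cfQ a (n + 2 * (k + 1)) * cfQ a (n + 2 * k)) := by
      have h₁ := (hpos (n + 2 * (k + 1))).ne'
      have h₂ := (hpos (n + 2 * k)).ne'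
      simp only [u]
      rw [← mul_sub, div_sub_div _ _ h₁ h₂, ← mul_div_assoc]
      congr 1
      rw [hP, hQ]
      linear_combination (-1) ^ n * (a (n + 2 * k + 2) : ℝ) * hd + (a (n + 2 * k + 2) : ℝ) * hsq
    rw [key]
    positivity
  have hlim : Tendsto u atTop (nhds ((-1) ^ n * α)) := by
    refine Tendsto.const_mul _ (h.2.comp (tendsto_atTop_mono (fun k => ?_) tendsto_id))
    simp only [id]
    omega
  have h₀ : u 0 ≤ (-1) ^ n * α := hmono.ge_of_tendsto hlim 0
  have h₁ := mul_le_mul_of_nonneg_right h₀ (hpos n).le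
  simp only [u, mul_zero, add_zero] at h₁
  rw [mul_assoc, div_mul_cancel₀ _ (hpos n).ne'] at h₁
  linarith

lemma IsCF.abs_error_le {α : ℝ} (h : IsCF a α) (n : ℕ) :
    |(cfQ a n : ℝ) * α - cfP a n| ≤ 1 / cfQ a (n + 1) := by
  have hq : (0 : ℝ) < cfQ a (n + 1) := by exact_mod_cast cfQ_pos h.1 (n + 1)
  have hq' : (0 : ℝ) < cfQ a n := by exact_mod_cast cfQ_pos h.1 n
  have h₀ := h.signed_error_nonneg n
  have h₁ := h.signed_error_nonneg (n + 1)
  have hd := cfP_mul_cfQ_sub a n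
  have habs : |(cfQ a n : ℝ) * α - cfP a n| = (-1) ^ n * ((cfQ a n : ℝ) * α - cfP a n) := by
    rw [← abs_of_nonneg h₀, abs_mul, abs_pow]
    simp
  have hsq : ((-1 : ℝ) ^ n) * (-1) ^ n = 1 := by rw [← mul_pow]; simp
  rw [habs, le_div_iff₀ hq]
  have := mul_nonneg h₁ hq'.le
  rw [pow_succ] at this
  nlinarith [congrArg (fun t => (-1) ^ n * t) hd]

end Continuants

section BadlyApproximable

variable {α : ℝ}

lemma IsBad.exists_le (h : IsBad α) :
    ∃ c : ℝ, 0 < c ∧ ∀ q : ℕ, 0 < q → c ≤ q * nint (q * α) := by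
  refine ⟨_, h, fun q hq => ?_⟩
  have hb : BddBelow (Set.range fun q : ℕ+ => ((q : ℕ) : ℝ) * nint (((q : ℕ) : ℝ) * α)) :=
    ⟨0, by rintro _ ⟨q, rfl⟩; exact mul_nonneg (Nat.cast_nonneg _) (nint_nonneg _)⟩
  exact ciInf_le hb ⟨q, hq⟩

lemma IsBad.linear_form_ne_zero (h : IsBad α) {C D : ℤ} (hCD : C ≠ 0 ∨ D ≠ 0) :
    (C : ℝ) * α + D ≠ 0 := by
  intro h₀
  have hC : C ≠ 0 := by
    rintro rfl
    simp at h₀ hCD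
    exact hCD h₀
  obtain ⟨c, hc, hle⟩ := h.exists_le
  have h₁ := hle C.natAbs (Int.natAbs_pos.mpr hC)
  have h₂ := nint_natAbs_mul_le C (-D) α
  rw [Int.cast_neg, sub_neg_eq_add, h₀, abs_zero] at h₂
  rw [le_antisymm h₂ (nint_nonneg _), mul_zero] at h₁
  linarith

lemma IsBad.exists_cfQ_le_pow {a : ℕ → ℕ} (h : IsBad α) (hcf : IsCF a α) :
    ∃ K : ℝ, 0 < K ∧ ∀ n, (cfQ a n : ℝ) ≤ K ^ n := by
  obtain ⟨c, hc, hle⟩ := h.exists_le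
  refine ⟨c⁻¹, inv_pos.mpr hc, fun n => ?_⟩
  induction n with
  | zero => simp [cfQ]
  | succ n ih =>
    have hq : (0 : ℝ) < cfQ a (n + 1) := by exact_mod_cast cfQ_pos hcf.1 (n + 1)
    have h₁ := hle _ (cfQ_pos hcf.1 n)
    have h₂ := (nint_le_abs_sub_intCast ((cfQ a n : ℝ) * α) (cfP a n)).trans
      (by exact_mod_cast hcf.abs_error_le n)
    have h₃ := h₁.trans (mul_le_mul_of_nonneg_left h₂ (Nat.cast_nonneg _))
    rw [mul_one_div, le_div_iff₀ hq] at h₃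
    rw [pow_succ, ← div_eq_mul_inv, le_div_iff₀ hc]
    linarith

end BadlyApproximable

section Palindromes

/-- The elementary matrix of a partial quotient. -/
def cfMat (c : ℕ) : Matrix (Fin 2) (Fin 2) ℤ := !![(c : ℤ), 1; 1, 0]

/-- The product of the elementary matrices of the first `n` partial quotients. -/
def cfProd (a : ℕ → ℕ) : ℕ → Matrix (Fin 2) (Fin 2) ℤ
  | 0 => 1
  | n + 1 => cfProd a n * cfMat (a (n + 1))

variable {a : ℕ → ℕ}

lemma cfProd_succ_eq (a : ℕ → ℕ) (n : ℕ) :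
    cfProd a (n + 1) = !![(cfQ a (n + 1) : ℤ), cfQ a n; cfP a (n + 1), cfP a n] := by
  induction n with
  | zero => simp [cfProd, cfMat, cfQ, cfP]
  | succ n ih =>
    rw [cfProd, ih, cfMat, Matrix.mul_fin_two, show n + 1 + 1 = n + 2 from rfl, cfQ, cfP]
    push_cast
    congr 3 <;> ring_nf

lemma cfProd_eq_prod_of_prefix (W : List ℕ)
    (hW : ∀ i < W.length, a (i + 1) = W.getD i 0) :
    cfProd a W.length = (W.map cfMat).prod := by
  induction W using List.reverseRecOn with
  | nil => simp [cfProd]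
  | append_singleton W c ih =>
    have hc := hW W.length (by simp)
    have hi := ih fun i hi => by
      rw [hW i (by simp; omega), List.getD_append _ _ _ _ hi]
    rw [List.length_append, List.length_singleton, cfProd, hi, hc]
    simp

lemma prod_map_cfMat_reverse (W : List ℕ) :
    (W.reverse.map cfMat).prod = ((W.map cfMat).prod).transpose := by
  have ht : ∀ c, (cfMat c).transpose = cfMat c := fun c => by
    ext i j
    fin_cases i <;> fin_cases j <;> rfl
  rw [Matrix.transpose_list_prod, List.map_map, List.map_reverse]
  congr 2
  exact List.map_congr_left fun c _ => (ht c).symm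

/-- Completing the palindrome turns the matrix of a prefix `V U Ū` into a symmetric matrix. -/
lemma cfProd_mul_transpose_symm {V U : List ℕ}
    (h : ∀ i < (V ++ U ++ U.reverse).length, a (i + 1) = (V ++ U ++ U.reverse).getD i 0) :
    (cfProd a (V.length + 2 * U.length) * (cfProd a V.length).transpose).IsSymm := by
  have hV : cfProd a V.length = (V.map cfMat).prod :=
    cfProd_eq_prod_of_prefix V fun i hi => by
      rw [h i (by simp; omega), List.append_assoc, List.getD_append _ _ _ _ hi]
  have hW := cfProd_eq_prod_of_prefix _ h
  have hlen : (V ++ U ++ U.reverse).length = V.length + 2 * U.length := by simp; ring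
  rw [hlen] at hW
  rw [hW, hV, List.map_append, List.map_append, List.prod_append, List.prod_append,
    prod_map_cfMat_reverse, Matrix.IsSymm]
  simp [Matrix.mul_assoc]

variable {α : ℝ}

lemma IsCF.cfProd_bounds (h : IsCF a α) (n : ℕ) :
    cfProd a n 0 0 = cfQ a n ∧
    (0 ≤ cfProd a n 0 1 ∧ cfProd a n 0 1 ≤ cfQ a n) ∧
    (0 ≤ cfProd a n 1 0 ∧ cfProd a n 1 0 ≤ cfQ a n) ∧
    (0 ≤ cfProd a n 1 1 ∧ cfProd a n 1 1 ≤ cfQ a n) ∧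
    |(cfProd a n 0 0 : ℝ) * α - cfProd a n 1 0| ≤ 1 / cfQ a n ∧
    |(cfProd a n 0 1 : ℝ) * α - cfProd a n 1 1| ≤ 1 / cfQ a n := by
  have hmono := cfQ_monotone h.1
  have hP := cfP_le_cfQ h.1
  have hpos := cfQ_pos h.1
  have herr : ∀ n, |(cfQ a n : ℝ) * α - cfP a n| ≤ 1 / cfQ a n := fun n =>
    (h.abs_error_le n).trans <| one_div_le_one_div_of_le (by exact_mod_cast hpos n)
      (by exact_mod_cast hmono (Nat.le_succ n))
  cases n with
  | zero =>
    have h₀ := herr 0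
    simp [cfQ, cfP] at h₀
    simp [cfProd, cfQ, h₀]
  | succ n =>
    have h₁ : cfQ a n ≤ cfQ a (n + 1) := hmono (Nat.le_succ n)
    rw [cfProd_succ_eq]
    simp only [Matrix.of_apply, Matrix.cons_val', Matrix.cons_val_zero, Matrix.cons_val_one,
      Matrix.cons_val_fin_one, Int.cast_natCast]
    exact ⟨trivial, ⟨by positivity, by exact_mod_cast h₁⟩,
      ⟨by positivity, by exact_mod_cast hP _⟩,
      ⟨by positivity, by exact_mod_cast (hP n).trans h₁⟩, herr _, h.abs_error_le n⟩

/-- A prefix `V U Ū` yields integers `q`, `p` such that `q α` is close to `p` and `p α` is close to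
an integer. -/
lemma IsCF.exists_approx_of_palindrome (h : IsCF a α) {V U : List ℕ}
    (hW : ∀ i < (V ++ U ++ U.reverse).length, a (i + 1) = (V ++ U ++ U.reverse).getD i 0) :
    ∃ q p p' : ℤ,
      (cfQ a (V.length + 2 * U.length) : ℝ) ≤ q ∧
      (q : ℝ) ≤ 2 * cfQ a (V.length + 2 * U.length) * cfQ a V.length ∧
      |(p : ℝ)| ≤ 2 * cfQ a (V.length + 2 * U.length) * cfQ a V.length ∧
      |(q : ℝ) * α - p| ≤ 2 * cfQ a V.length / cfQ a (V.length + 2 * U.length) ∧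
      |(p : ℝ) * α - p'| ≤ 2 * cfQ a V.length / cfQ a (V.length + 2 * U.length) := by
  have hsymm := cfProd_mul_transpose_symm hW
  set r := V.length
  set N := r + 2 * U.length
  obtain ⟨h00, ⟨h01, h01'⟩, ⟨h10, h10'⟩, ⟨h11, h11'⟩, he, he'⟩ := h.cfProd_bounds N
  obtain ⟨g00, ⟨g01, g01'⟩, ⟨g10, g10'⟩, ⟨g11, g11'⟩, -, -⟩ := h.cfProd_bounds r
  have hN : (0 : ℝ) < cfQ a N := by exact_mod_cast cfQ_pos h.1 N
  have hr : (1 : ℝ) ≤ cfQ a r := by exact_mod_cast cfQ_pos h.1 r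
  have hs := hsymm.apply 0 1
  simp only [Matrix.mul_apply, Fin.sum_univ_two, Matrix.transpose_apply] at hs
  have hs' : (cfProd a N 1 0 * cfProd a r 0 0 + cfProd a N 1 1 * cfProd a r 0 1 : ℝ)
      = cfProd a N 0 0 * cfProd a r 1 0 + cfProd a N 0 1 * cfProd a r 1 1 := by
    exact_mod_cast hs
  have h00r : (cfProd a N 0 0 : ℝ) = cfQ a N := by exact_mod_cast congrArg (Int.cast : ℤ → ℝ) h00
  have g00r : (cfProd a r 0 0 : ℝ) = cfQ a r := by exact_mod_cast congrArg (Int.cast : ℤ → ℝ) g00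
  rify at h01 h01' h10 h10' h11 h11' g01 g01' g10 g10' g11 g11'
  rw [h00r, g00r] at hs'
  rw [h00r] at he
  have combine : ∀ {s t : ℝ}, 0 ≤ s → s ≤ cfQ a r → 0 ≤ t → t ≤ cfQ a r →
      |s * ((cfQ a N : ℝ) * α - cfProd a N 1 0) + t * ((cfProd a N 0 1 : ℝ) * α - cfProd a N 1 1)|
        ≤ 2 * cfQ a r / cfQ a N := by
    intro s t hs₀ hs₁ ht₀ ht₁
    refine (abs_add_le _ _).trans ?_
    rw [abs_mul, abs_mul, abs_of_nonneg hs₀, abs_of_nonneg ht₀]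
    have e₁ := mul_le_mul hs₁ he (abs_nonneg _) (by positivity)
    have e₂ := mul_le_mul ht₁ he' (abs_nonneg _) (by positivity)
    refine (add_le_add e₁ e₂).trans_eq ?_
    ring
  refine ⟨cfProd a N 0 0 * cfProd a r 0 0 + cfProd a N 0 1 * cfProd a r 0 1,
    cfProd a N 0 0 * cfProd a r 1 0 + cfProd a N 0 1 * cfProd a r 1 1,
    cfProd a N 1 0 * cfProd a r 1 0 + cfProd a N 1 1 * cfProd a r 1 1, ?_, ?_, ?_, ?_, ?_⟩ <;>
    push_cast <;> rw [h00r] <;> try rw [g00r]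
  · nlinarith [mul_nonneg h01 g01]
  · nlinarith [mul_le_mul h01' g01' g01 hN.le]
  · rw [abs_of_nonneg (by positivity)]
    nlinarith [mul_le_mul h01' g11' g11 hN.le, mul_le_mul_of_nonneg_left g10' hN.le]
  · rw [← hs']
    convert combine (zero_le_one.trans hr) le_rfl g01 g01' using 2
    ring
  · convert combine g10 g10' g11 g11' using 2
    ring

end Palindromes

section Growth

variable {a : ℕ → ℕ} {α : ℝ}

lemma log_cfQ_rpow_one_div (ha : ∀ i, 1 ≤ i → 1 ≤ a i) {l : ℕ} (hl : 1 ≤ l) :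
    Real.log (cfQ a l) = l * Real.log ((cfQ a l : ℝ) ^ (1 / (l : ℝ))) := by
  have hq : (0 : ℝ) < cfQ a l := by exact_mod_cast cfQ_pos ha l
  have hl' : (l : ℝ) ≠ 0 := by positivity
  rw [Real.log_rpow hq]
  field_simp

lemma IsCF.isBoundedUnder_le_root (h : IsCF a α) (hbad : IsBad α) :
    IsBoundedUnder (· ≤ ·) atTop (fun l : ℕ => (cfQ a l : ℝ) ^ (1 / (l : ℝ))) := by
  obtain ⟨K, hK, hle⟩ := hbad.exists_cfQ_le_pow h
  refine ⟨K, eventually_map.mpr ?_⟩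
  filter_upwards [eventually_ge_atTop 1] with l hl
  have hl' : l ≠ 0 := by omega
  calc (cfQ a l : ℝ) ^ (1 / (l : ℝ)) ≤ (K ^ l) ^ (1 / (l : ℝ)) :=
        Real.rpow_le_rpow (Nat.cast_nonneg _) (hle l) (by positivity)
    _ = K := by rw [one_div, Real.pow_rpow_inv_natCast hK.le hl']

lemma isBoundedUnder_ge_root (a : ℕ → ℕ) :
    IsBoundedUnder (· ≥ ·) atTop (fun l : ℕ => (cfQ a l : ℝ) ^ (1 / (l : ℝ))) :=
  ⟨0, eventually_map.mpr (Eventually.of_forall fun _ => by positivity)⟩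

lemma IsCF.one_lt_liminf_root (h : IsCF a α) (hbad : IsBad α) :
    1 < liminf (fun l : ℕ => (cfQ a l : ℝ) ^ (1 / (l : ℝ))) atTop := by
  have h₁ : (1 : ℝ) < 2 ^ (1 / 4 : ℝ) := Real.one_lt_rpow (by norm_num) (by norm_num)
  refine h₁.trans_le (le_liminf_of_le (h.isBoundedUnder_le_root hbad).isCoboundedUnder_ge ?_)
  filter_upwards [eventually_ge_atTop 2] with l hl
  obtain ⟨n, rfl⟩ := Nat.exists_eq_add_of_le' hl
  have h₂ : (2 : ℝ) ^ (n + 2) ≤ (cfQ a (n + 2) : ℝ) ^ 4 := by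
    exact_mod_cast two_pow_le_cfQ_pow_four h.1 n
  have hl' : ((n + 2 : ℕ) : ℝ) ≠ 0 := by positivity
  have h₃ : (2 : ℝ) ^ (((n + 2 : ℕ) : ℝ) * (1 / 4)) ≤ cfQ a (n + 2) := by
    rw [Real.rpow_mul zero_le_two, Real.rpow_natCast]
    refine (Real.rpow_le_rpow (by positivity) h₂ (by norm_num)).trans_eq ?_
    rw [one_div]
    exact_mod_cast Real.pow_rpow_inv_natCast (Nat.cast_nonneg (cfQ a (n + 2))) four_ne_zero
  calc (2 : ℝ) ^ (1 / 4 : ℝ)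
      = ((2 : ℝ) ^ (((n + 2 : ℕ) : ℝ) * (1 / 4))) ^ (1 / ((n + 2 : ℕ) : ℝ)) := by
        rw [← Real.rpow_mul zero_le_two]
        congr 1
        field_simp
    _ ≤ _ := Real.rpow_le_rpow (by positivity) h₃ (by positivity)

lemma IsCF.exists_log_cfQ_le (h : IsCF a α) (hbad : IsBad α) {L : ℝ}
    (hL : Real.log (limsup (fun l : ℕ => (cfQ a l : ℝ) ^ (1 / (l : ℝ))) atTop) < L) :
    ∃ c, ∀ l : ℕ, Real.log (cfQ a l) ≤ c + l * L := by
  have hlt : limsup (fun l : ℕ => (cfQ a l : ℝ) ^ (1 / (l : ℝ))) atTop < Real.exp L :=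
    Real.lt_exp_of_log_lt hL
  have hev := eventually_lt_of_limsup_lt hlt (h.isBoundedUnder_le_root hbad)
  have hb : IsBoundedUnder (· ≤ ·) atTop (fun l : ℕ => Real.log (cfQ a l) - l * L) := by
    refine ⟨0, eventually_map.mpr ?_⟩
    filter_upwards [hev, eventually_ge_atTop 1] with l hl hl₁
    have hq : (0 : ℝ) < cfQ a l := by exact_mod_cast cfQ_pos h.1 l
    rw [log_cfQ_rpow_one_div h.1 hl₁, sub_nonpos]
    exact mul_le_mul_of_nonneg_left
      ((Real.log_le_iff_le_exp (Real.rpow_pos_of_pos hq _)).mpr hl.le) (Nat.cast_nonneg _)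
  obtain ⟨c, hc⟩ := hb.bddAbove_range
  exact ⟨c, fun l => by linarith [hc ⟨l, rfl⟩]⟩

lemma IsCF.exists_le_log_cfQ (h : IsCF a α) (hbad : IsBad α) {L : ℝ}
    (hL : L < Real.log (liminf (fun l : ℕ => (cfQ a l : ℝ) ^ (1 / (l : ℝ))) atTop)) :
    ∃ c, ∀ l : ℕ, l * L ≤ Real.log (cfQ a l) + c := by
  have hlt := (Real.lt_log_iff_exp_lt (zero_lt_one.trans (h.one_lt_liminf_root hbad))).mp hL
  have hev := eventually_lt_of_lt_liminf hlt (isBoundedUnder_ge_root a)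
  have hb : IsBoundedUnder (· ≤ ·) atTop (fun l : ℕ => l * L - Real.log (cfQ a l)) := by
    refine ⟨0, eventually_map.mpr ?_⟩
    filter_upwards [hev, eventually_ge_atTop 1] with l hl hl₁
    have hq : (0 : ℝ) < cfQ a l := by exact_mod_cast cfQ_pos h.1 l
    rw [log_cfQ_rpow_one_div h.1 hl₁, sub_nonpos]
    exact mul_le_mul_of_nonneg_left
      ((Real.le_log_iff_exp_le (Real.rpow_pos_of_pos hq _)).mpr hl.le) (Nat.cast_nonneg _)
  obtain ⟨c, hc⟩ := hb.bddAbove_range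
  exact ⟨c, fun l => by linarith [hc ⟨l, rfl⟩]⟩

lemma IsCF.exists_cfQ_cube_le (h : IsCF a α) (hbad : IsBad α) {x : ℝ} (hx : 0 < x)
    (hcond : (3 / 2) * Real.log (limsup (fun l : ℕ => (cfQ a l : ℝ) ^ (1 / (l : ℝ))) atTop)
      / Real.log (liminf (fun l : ℕ => (cfQ a l : ℝ) ^ (1 / (l : ℝ))) atTop) - 1 / 2 < x) :
    ∃ δ : ℝ, 0 < δ ∧ δ < 1 ∧ ∃ K : ℝ, 0 < K ∧ ∀ r N : ℕ, (2 * x + 1) * r ≤ N →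
      (cfQ a r : ℝ) ^ 3 ≤ K * (cfQ a N : ℝ) ^ (1 - δ) := by
  have hm := Real.log_pos (h.one_lt_liminf_root hbad)
  set lM := Real.log (limsup (fun l : ℕ => (cfQ a l : ℝ) ^ (1 / (l : ℝ))) atTop) with hlM
  set lm := Real.log (liminf (fun l : ℕ => (cfQ a l : ℝ) ^ (1 / (l : ℝ))) atTop) with hlm
  have hT : 0 < 2 * x + 1 := by linarith
  have hgap : lM < (2 * x + 1) * lm / 3 := by
    have h₁ : (3 / 2) * lM / lm < x + 1 / 2 := by linarith
    rw [div_lt_iff₀ hm] at h₁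
    linarith
  obtain ⟨L, hL, hL'⟩ := exists_between hgap
  have h₂ : max (3 * L / (2 * x + 1)) 0 < lm := by
    refine max_lt ?_ hm
    rw [div_lt_iff₀ hT]
    linarith
  obtain ⟨l, hl, hl'⟩ := exists_between h₂
  obtain ⟨hl₁, hl₀⟩ := max_lt_iff.mp hl
  have h₃ : max (3 * L / (2 * x + 1) / l) 0 < 1 :=
    max_lt ((div_lt_one hl₀).mpr hl₁) zero_lt_one
  obtain ⟨κ, hκ, hκ'⟩ := exists_between h₃
  obtain ⟨hκ₁, hκ₀⟩ := max_lt_iff.mp hκ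
  rw [div_lt_iff₀ hl₀, div_lt_iff₀ hT] at hκ₁
  obtain ⟨c, hc⟩ := h.exists_log_cfQ_le hbad hL
  obtain ⟨d, hd⟩ := h.exists_le_log_cfQ hbad hl'
  refine ⟨1 - κ, by linarith, by linarith, Real.exp (3 * c + κ * d), Real.exp_pos _,
    fun r N hrN => ?_⟩
  have hr : (0 : ℝ) < cfQ a r := by exact_mod_cast cfQ_pos h.1 r
  have hN : (0 : ℝ) < cfQ a N := by exact_mod_cast cfQ_pos h.1 N
  rw [sub_sub_cancel, ← Real.log_le_log_iff (by positivity) (by positivity),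
    Real.log_mul (Real.exp_pos _).ne' (by positivity), Real.log_exp, Real.log_rpow hN,
    Real.log_pow]
  have e₁ := hc r
  have e₂ := mul_le_mul_of_nonneg_left (hd N) hκ₀.le
  have e₃ := mul_le_mul_of_nonneg_left hκ₁.le (Nat.cast_nonneg (α := ℝ) r)
  have e₄ := mul_le_mul_of_nonneg_left hrN (mul_pos hκ₀ hl₀).le
  push_cast
  linarith

end Growth

/-- If `q α` is close to `p` and `p α` is close to an integer, then `|C p + D q|` is a simultaneous
denominator for `α` and `(A α + B) / (C α + D)`. -/
lemma nint_mul_homography_le {α β : ℝ} {A B C D q p p' : ℤ} {e : ℝ}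
    (hden : (C : ℝ) * α + D ≠ 0) (hβ : β = ((A : ℝ) * α + B) / ((C : ℝ) * α + D))
    (hq : |(q : ℝ) * α - p| ≤ e) (hp : |(p : ℝ) * α - p'| ≤ e) :
    nint (((C * p + D * q).natAbs : ℝ) * α) ≤ (|(C : ℝ)| + |(D : ℝ)|) * e ∧
    nint (((C * p + D * q).natAbs : ℝ) * β) ≤ |(C : ℝ) * β - A| * e := by
  constructor
  · refine (nint_natAbs_mul_le _ (C * p' + D * p) _).trans ?_
    have : ((C * p + D * q : ℤ) : ℝ) * α - ((C * p' + D * p : ℤ) : ℝ)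
        = C * (p * α - p') + D * (q * α - p) := by
      push_cast
      ring
    rw [this, add_mul]
    refine (abs_add_le _ _).trans ?_
    rw [abs_mul, abs_mul]
    gcongr
  · refine (nint_natAbs_mul_le _ (A * p + B * q) _).trans ?_
    have hβ' : β * (C * α + D) = A * α + B := by rw [hβ, div_mul_cancel₀ _ hden]
    have : ((C * p + D * q : ℤ) : ℝ) * β - ((A * p + B * q : ℤ) : ℝ)
        = -((C * β - A) * (q * α - p)) := by
      push_cast
      linear_combination (q : ℝ) * hβ'
    rw [this, abs_neg, abs_mul]
    gcongr

/-- refinement of Theorem 5.  Under the hypotheses of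
Statement 4 — `α` badly approximable whose expansion begins, for each `k`,
with `V k` followed by `U k` followed by the mirror image of `U k`, with
`|U (k+1)| > |U k| ≥ x·|V k|` and `x > (3/2)·log M / log m - 1/2` — there is a
real `ε` with `0 < ε < 1`, depending on `x`, such that for every `β` equal to
`α` up to a rational homography there are infinitely many positive integers
`q` with `q·‖qα‖·‖qβ‖ ≤ q^{-(1-ε)}`. -/
theorem littlewood_rate_of_palindromic_blocks
    (α : ℝ) (a : ℕ → ℕ) (hcf : IsCF a α) (hbad : IsBad α)
    (x : ℚ) (hx : 0 < x) (U V : ℕ → List ℕ)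
    (hpre : ∀ k : ℕ, 1 ≤ k →
      ∀ i < (V k ++ U k ++ (U k).reverse).length,
        a (i + 1) = (V k ++ U k ++ (U k).reverse).getD i 0)
    (hlen₁ : ∀ k : ℕ, 1 ≤ k → (U k).length < (U (k + 1)).length)
    (hlen₂ : ∀ k : ℕ, 1 ≤ k → x * ((V k).length : ℚ) ≤ ((U k).length : ℚ))
    (M m : ℝ)
    (hM : M = limsup (fun l : ℕ => (cfQ a l : ℝ) ^ (1 / (l : ℝ))) atTop)
    (hm : m = liminf (fun l : ℕ => (cfQ a l : ℝ) ^ (1 / (l : ℝ))) atTop)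
    (hcond : (3 / 2) * Real.log M / Real.log m - 1 / 2 < (x : ℝ)) :
    ∃ ε : ℝ, 0 < ε ∧ ε < 1 ∧
      ∀ (β : ℝ) (A B C D : ℤ), A * D - B * C ≠ 0 →
        β = ((A : ℝ) * α + B) / ((C : ℝ) * α + D) →
        {q : ℕ | 1 ≤ q ∧
            (q : ℝ) * nint ((q : ℝ) * α) * nint ((q : ℝ) * β)
              ≤ (q : ℝ) ^ (-(1 - ε))}.Infinite := by
  subst hM hm
  obtain ⟨δ, hδ, hδ₁, K, hK, hcube⟩ := hcf.exists_cfQ_cube_le hbad (Rat.cast_pos.mpr hx) hcond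
  refine ⟨1 - δ / 4, by linarith, by linarith, fun β A B C D hdet hβ => ?_⟩
  rw [sub_sub_cancel]
  have hCD : C ≠ 0 ∨ D ≠ 0 := by
    by_contra! h
    simp [h.1, h.2] at hdet
  have hden := hbad.linear_form_ne_zero hCD
  set κ := |(C : ℝ) * α + D| with hκ
  have hκ₀ : 0 < κ := abs_pos.mpr hden
  set S := |(C : ℝ)| + |(D : ℝ)| with hS
  have hS₀ : 0 < S := by
    rcases hCD with h | h <;> positivity
  set R := |(C : ℝ) * β - A| with hR
  have hlarge : Tendsto (fun k => (cfQ a ((V k).length + 2 * (U k).length) : ℝ)) atTop atTop := by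
    refine tendsto_natCast_atTop_atTop.comp (tendsto_atTop_mono' _ (f₁ := fun k => k - 1) ?_
      (tendsto_sub_atTop_nat 1))
    filter_upwards [eventually_ge_atTop 1] with k hk
    have hU : k - 1 ≤ (U k).length := by
      induction k, hk using Nat.le_induction with
      | base => simp
      | succ k hk ih => have := hlen₁ k hk; omega
    exact (show k - 1 ≤ (V k).length + 2 * (U k).length by omega).trans (le_cfQ hcf.1 _)
  refine Set.infinite_of_forall_exists_gt fun n => ?_
  have hpow := (tendsto_rpow_atTop (half_pos hδ)).comp hlarge
  obtain ⟨k, hk₁, hk₂, hk₃⟩ := ((eventually_ge_atTop 1).and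
    ((hlarge.eventually_ge_atTop ((n + 1 + 2 * |(C : ℝ)|) / κ)).and
      (hpow.eventually_ge_atTop (8 * S ^ 2 * R * K * (2 * S) ^ (δ / 4))))).exists
  obtain ⟨q, p, p', hq, hq', hp', he, he'⟩ := hcf.exists_approx_of_palindrome (hpre k hk₁)
  have hrN : (2 * (x : ℝ) + 1) * (V k).length ≤ ((V k).length + 2 * (U k).length : ℕ) := by
    have : (x : ℝ) * (V k).length ≤ (U k).length := by exact_mod_cast hlen₂ k hk₁
    push_cast
    linarith
  have hc := hcube _ _ hrN
  have hmono : (cfQ a (V k).length : ℝ) ≤ cfQ a ((V k).length + 2 * (U k).length) := by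
    exact_mod_cast cfQ_monotone hcf.1 (Nat.le_add_right _ _)
  have hr : (0 : ℝ) < cfQ a (V k).length := by exact_mod_cast cfQ_pos hcf.1 _
  simp only [Function.comp_apply] at hk₃
  generalize (cfQ a ((V k).length + 2 * (U k).length) : ℝ) = Y at *
  generalize (cfQ a (V k).length : ℝ) = y at *
  have hY : 0 < Y := hr.trans_le hmono
  obtain ⟨hα', hβ'⟩ := nint_mul_homography_le hden hβ he he'
  set Q := (C * p + D * q).natAbs with hQ
  have hQabs : (Q : ℝ) = |(C : ℝ) * p + D * q| := by
    rw [hQ, Nat.cast_natAbs]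
    push_cast
    rfl
  have hlow : (n : ℝ) + 1 ≤ Q := by
    have h₁ : (q : ℝ) * (C * α + D) = (C * p + D * q) + C * (q * α - p) := by ring
    have h₂ : |(q : ℝ)| * κ ≤ Q + |(C : ℝ)| * |(q : ℝ) * α - p| := by
      rw [hκ, ← abs_mul, h₁, hQabs, ← abs_mul]
      exact abs_add_le _ _
    have h₃ : |(q : ℝ) * α - p| ≤ 2 := he.trans <| (div_le_iff₀ hY).mpr (by linarith)
    have h₄ := mul_le_mul_of_nonneg_left h₃ (abs_nonneg (C : ℝ))
    have h₅ := mul_le_mul_of_nonneg_right (hq.trans (le_abs_self _)) hκ₀.le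
    rw [div_le_iff₀ hκ₀] at hk₂
    linarith
  have hup : (Q : ℝ) ≤ S * (2 * Y * y) := by
    rw [hQabs, hS, add_mul]
    refine (abs_add_le _ _).trans ?_
    rw [abs_mul, abs_mul, abs_of_nonneg (hY.le.trans hq)]
    gcongr
  have hQ₀ : (0 : ℝ) < Q := by linarith [Nat.cast_nonneg (α := ℝ) n]
  refine ⟨Q, ⟨?_, ?_⟩, ?_⟩
  · exact_mod_cast (show (1 : ℝ) ≤ Q by linarith [Nat.cast_nonneg (α := ℝ) n])
  · have hprod : (Q : ℝ) * nint (Q * α) * nint (Q * β) ≤ 8 * S ^ 2 * R * y ^ 3 / Y := by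
      calc (Q : ℝ) * nint (Q * α) * nint (Q * β)
          ≤ S * (2 * Y * y) * (S * (2 * y / Y)) * (R * (2 * y / Y)) := by
            have := nint_nonneg ((Q : ℝ) * α)
            have := nint_nonneg ((Q : ℝ) * β)
            gcongr
        _ = 8 * S ^ 2 * R * y ^ 3 / Y := by
            field_simp
            ring
    have hsplit : Y ^ (1 - δ) / Y * Y ^ (δ / 2) * (Y ^ 2) ^ (δ / 4) = 1 := by
      rw [← Real.rpow_natCast, ← Real.rpow_mul hY.le, ← Real.rpow_sub_one hY.ne',
        ← Real.rpow_add hY, ← Real.rpow_add hY]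
      push_cast
      rw [show 1 - δ - 1 + δ / 2 + 2 * (δ / 4) = 0 by ring, Real.rpow_zero]
    have hQpow : (Q : ℝ) ^ (δ / 4) ≤ (2 * S) ^ (δ / 4) * (Y ^ 2) ^ (δ / 4) := by
      rw [← Real.mul_rpow (by positivity) (by positivity)]
      refine Real.rpow_le_rpow hQ₀.le (hup.trans ?_) (by linarith)
      nlinarith [mul_le_mul_of_nonneg_left hmono (mul_pos hS₀ hY).le]
    rw [Real.rpow_neg hQ₀.le, ← one_div, le_div_iff₀ (Real.rpow_pos_of_pos hQ₀ _)]
    calc (Q : ℝ) * nint (Q * α) * nint (Q * β) * (Q : ℝ) ^ (δ / 4)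
        ≤ (8 * S ^ 2 * R * (K * Y ^ (1 - δ)) / Y) * ((2 * S) ^ (δ / 4) * (Y ^ 2) ^ (δ / 4)) := by
          refine mul_le_mul (hprod.trans ?_) hQpow (by positivity) (by positivity)
          gcongr
      _ = (8 * S ^ 2 * R * K * (2 * S) ^ (δ / 4)) * (Y ^ (1 - δ) / Y * (Y ^ 2) ^ (δ / 4)) := by
          ring
      _ ≤ Y ^ (δ / 2) * (Y ^ (1 - δ) / Y * (Y ^ 2) ^ (δ / 4)) := by gcongr
      _ = 1 := by linear_combination hsplit
  · exact_mod_cast (show (n : ℝ) < Q by linarith)
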